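/- Let R be a commutative ring and M a projective R-module. Then the trace ideal tr_R(M) is a pure ideal of R, i.e. R/tr_R(M) is a flat R-module. -/

import Mathlib

/-- The trace ideal of a module `M`: the sum of the ranges of all linear maps `M → R`. -/
def traceIdeal (R : Type*) [CommRing R] (M : Type*) [AddCommGroup M] [Module R M] :
    Ideal R :=
  ⨆ f : M →ₗ[R] R, LinearMap.range f

lemma apply_mem_traceIdeal {R M : Type*} [CommRing R] [AddCommGroup M] [Module R M]
    (f : M →ₗ[R] R) (m : M) : f m ∈ traceIdeal R M :=
  le_iSup (fun f : M →ₗ[R] R => LinearMap.range f) f ⟨m, rfl⟩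

/-- Every element of a projective module is killed by an element congruent to `1` modulo the
trace ideal. -/
lemma exists_sub_one_mem_traceIdeal_smul_eq_zero {R M : Type*} [CommRing R] [AddCommGroup M]
    [Module R M] [Module.Projective R M] (m : M) :
    ∃ r : R, r - 1 ∈ traceIdeal R M ∧ r • m = 0 := by
  obtain ⟨s, hs⟩ := Module.projective_def'.mp ‹Module.Projective R M›
  have hs' (x : M) : Finsupp.linearCombination R id (s x) = x := LinearMap.congr_fun hs x
  have hle : Ideal.span (Set.range (s m)) ≤
      traceIdeal R M • Ideal.span (Set.range (s m)) := by
    rw [Ideal.span_le]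
    rintro _ ⟨k, rfl⟩
    have hk : s m k = (s m).sum fun j c => c * s j k := by
      conv_lhs => rw [← hs' m]
      simp [Finsupp.linearCombination_apply, Finsupp.sum, map_sum, Finsupp.finsetSum_apply]
    rw [hk]
    refine Submodule.sum_mem _ fun j _ => ?_
    beta_reduce
    rw [mul_comm]
    exact Submodule.smul_mem_smul (apply_mem_traceIdeal (Finsupp.lapply k ∘ₗ s) j)
      (Ideal.subset_span ⟨j, rfl⟩)
  obtain ⟨r, hr, hr0⟩ := Submodule.exists_sub_one_mem_and_smul_eq_zero_of_fg_of_le_smul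
    (traceIdeal R M) _ (Submodule.fg_span (s m).finite_range) hle
  refine ⟨r, hr, ?_⟩
  have h0 : s (r • m) = 0 := by
    ext k
    simpa using hr0 _ (Ideal.subset_span ⟨k, rfl⟩)
  rw [← hs' (r • m), h0, map_zero]

lemma exists_sub_one_mem_traceIdeal_mul_eq_zero {R M : Type*} [CommRing R] [AddCommGroup M]
    [Module R M] [Module.Projective R M] {x : R} (hx : x ∈ traceIdeal R M) :
    ∃ r : R, r - 1 ∈ traceIdeal R M ∧ r * x = 0 := by
  rw [traceIdeal] at hx
  induction hx using Submodule.iSup_induction' with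
  | mem f x hx =>
    obtain ⟨m, rfl⟩ := hx
    obtain ⟨r, hr, hrm⟩ := exists_sub_one_mem_traceIdeal_smul_eq_zero (R := R) m
    exact ⟨r, hr, by rw [← smul_eq_mul, ← map_smul, hrm, map_zero]⟩
  | zero => exact ⟨1, by simp, by simp⟩
  | add x y _ _ hx hy =>
    obtain ⟨r, hr, hrx⟩ := hx
    obtain ⟨t, ht, hty⟩ := hy
    refine ⟨r * t, ?_, by linear_combination t * hrx + r * hty⟩
    rw [show r * t - 1 = t * (r - 1) + (t - 1) by ring]
    exact Ideal.add_mem _ (Ideal.mul_mem_left _ _ hr) ht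

/-- The trace ideal of a projective module over a commutative ring is a pure ideal. -/
theorem traceIdeal_pure (R M : Type*) [CommRing R] [AddCommGroup M] [Module R M]
    [Module.Projective R M] :
    Module.Flat R (R ⧸ traceIdeal R M) := by
  refine Ideal.Pure.of_inf_eq_mul _ fun J _ => le_antisymm ?_ Ideal.mul_le_inf
  rintro x ⟨hxI, hxJ⟩
  obtain ⟨r, hr, hrx⟩ := exists_sub_one_mem_traceIdeal_mul_eq_zero hxI
  rw [show x = -(r - 1) * x by linear_combination hrx]
  exact Ideal.mul_mem_mul (neg_mem hr) hxJ
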